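/- Let K ⊂ ℝ^d be a compact convex set with diam(K) ≤ 1, μ a probability measure with supp(μ) ⊂ K, F ⊂ K a closed nonempty set, and x, y ∈ K. Then D_μ([x,y]) ≤ D_{μ,F}(x,y) + (β/2)·‖x − y‖², where D_μ([x,y]) = ‖x − y‖ · ∫₀¹ d_μ((1−t)x + ty)^β dt is the FDTM length of the straight segment from x to y. -/

import Mathlib

open MeasureTheory Metric Set ProbabilityTheory
open scoped ENNReal NNReal

noncomputable section

/-- Euclidean space `ℝ^d`. -/
abbrev Euc (d : ℕ) := EuclideanSpace ℝ (Fin d)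

/-- The pseudo-distance-to-measure `δ_{μ,u}(x) = inf {r > 0 : μ(B(x,r)) > u}`. -/
def pseudoDTM {d : ℕ} (μ : Measure (Euc d)) (u : ℝ) (x : Euc d) : ℝ :=
  sInf {r : ℝ | 0 < r ∧ u < (μ (ball x r)).toReal}

/-- The distance-to-measure `d_μ(x) = ((1/m) ∫₀^m δ_{μ,u}(x)^p du)^{1/p}`. -/
def dtm {d : ℕ} (m p : ℝ) (μ : Measure (Euc d)) (x : Euc d) : ℝ :=
  ((1 / m) * ∫ u in Ioc (0 : ℝ) m, pseudoDTM μ u x ^ p) ^ (1 / p)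

/-- A Lipschitz path. -/
def IsLipschitzPath {d : ℕ} (γ : ℝ → Euc d) : Prop := ∃ K, LipschitzWith K γ

/-- Euclidean length `|γ| = ∫₀¹ ‖γ'(t)‖ dt`. -/
def eucLength {d : ℕ} (γ : ℝ → Euc d) : ℝ := ∫ t in Icc (0 : ℝ) 1, ‖deriv γ t‖

/-- FDTM length `D_μ(γ) = ∫₀¹ d_μ(γ(t))^β ‖γ'(t)‖ dt`. -/
def fdtmLength {d : ℕ} (m p β : ℝ) (μ : Measure (Euc d)) (γ : ℝ → Euc d) : ℝ :=
  ∫ t in Icc (0 : ℝ) 1, dtm m p μ (γ t) ^ β * ‖deriv γ t‖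

/-- Admissible paths `Γ_F(x,y)`: Lipschitz paths from `x` to `y` which may leave the domain `F`
only along straight lines. -/
def AdmissiblePath {d : ℕ} (F : Set (Euc d)) (x y : Euc d) (γ : ℝ → Euc d) : Prop :=
  IsLipschitzPath γ ∧ γ 0 = x ∧ γ 1 = y ∧
    ∀ a b : ℝ, 0 ≤ a → b ≤ 1 →
      (∀ t ∈ Ioo a b, γ t ∉ F) →
      ∃ u : Euc d, ‖u‖ = 1 ∧
        ∀ᵐ t ∂(volume.restrict (Ioo a b)), deriv γ t = ‖deriv γ t‖ • u

/-- The Fermat distance-to-measure `D_{μ,F}(x,y) = inf_{γ ∈ Γ_F(x,y)} D_μ(γ)`. -/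
def fdtm {d : ℕ} (m p β : ℝ) (μ : Measure (Euc d)) (F : Set (Euc d)) (x y : Euc d) : ℝ :=
  sInf {L : ℝ | ∃ γ : ℝ → Euc d, AdmissiblePath F x y γ ∧ L = fdtmLength m p β μ γ}

/-- A geodesic: an admissible path realizing the FDTM. -/
def IsGeodesic {d : ℕ} (m p β : ℝ) (μ : Measure (Euc d)) (F : Set (Euc d)) (x y : Euc d)
    (γ : ℝ → Euc d) : Prop :=
  AdmissiblePath F x y γ ∧ fdtmLength m p β μ γ = fdtm m p β μ F x y

/-- FDTM length of the straight segment `[x,y]`. -/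
def segFDTM {d : ℕ} (m p β : ℝ) (μ : Measure (Euc d)) (x y : Euc d) : ℝ :=
  ‖x - y‖ * ∫ t in Icc (0 : ℝ) 1, dtm m p μ ((1 - t) • x + t • y) ^ β

/-- The explicit constant `λ = 2·c·ρ^{β+1}/(ρ−1)` with `c = (16·5^β + 1152·165^β)/m^{2+β}`
and `ρ = 1 + 32/m`. -/
def fdtmConst (m β : ℝ) : ℝ :=
  2 * ((16 * (5 : ℝ) ^ β + 1152 * (165 : ℝ) ^ β) / m ^ (2 + β)) * (1 + 32 / m) ^ (β + 1) /
    ((1 + 32 / m) - 1)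

/-- Support of a measure: points all of whose neighborhoods have positive mass. -/
def measSupport {d : ℕ} (μ : Measure (Euc d)) : Set (Euc d) :=
  {x | ∀ r : ℝ, 0 < r → 0 < μ (ball x r)}

/-- `(a,b)`-standard measure: `μ(B(x,r)) ≥ a·r^b` for `x ∈ supp(μ)` and `0 < r ≤ a^{-1/b}`. -/
def IsStandard {d : ℕ} (μ : Measure (Euc d)) (a b : ℝ) : Prop :=
  ∀ x ∈ measSupport μ, ∀ r : ℝ, 0 < r → r ≤ a ^ (-(1 / b)) → a * r ^ b ≤ (μ (ball x r)).toReal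

section Path

theorem integral_const_add_mul (A c r : ℝ) :
    ∫ s in (0 : ℝ)..r, (A + c * s) = A * r + c * r ^ 2 / 2 := by
  rw [intervalIntegral.integral_add (by simp) (by apply Continuous.intervalIntegrable; fun_prop),
    intervalIntegral.integral_const_mul]
  simp
  ring

variable {E : Type*} [NormedAddCommGroup E] [NormedSpace ℝ E] [FiniteDimensional ℝ E]

theorem LipschitzWith.locallyIntegrable_deriv {C : ℝ≥0} {γ : ℝ → E} (hγ : LipschitzWith C γ) :
    LocallyIntegrable (deriv γ) volume := by
  borelize E
  have : CompleteSpace E := FiniteDimensional.complete ℝ E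
  refine (locallyIntegrable_const (C : ℝ)).mono
    (stronglyMeasurable_deriv γ).aestronglyMeasurable (.of_forall fun t => ?_)
  simpa using norm_deriv_le_of_lipschitz hγ

theorem LipschitzWith.intervalIntegrable_deriv {C : ℝ≥0} {γ : ℝ → E} (hγ : LipschitzWith C γ)
    (a b : ℝ) : IntervalIntegrable (deriv γ) volume a b :=
  (hγ.locallyIntegrable_deriv.integrableOn_isCompact isCompact_uIcc).intervalIntegrable

/-- The integral of a bounded function is Lipschitz in its upper endpoint. -/
theorem lipschitzWith_intervalIntegral {F : Type*} [NormedAddCommGroup F] [NormedSpace ℝ F]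
    {C : ℝ≥0} {g : ℝ → F} (hg : LocallyIntegrable g volume) (hC : ∀ t, ‖g t‖ ≤ C) (a : ℝ) :
    LipschitzWith C (fun t => ∫ s in a..t, g s) := by
  have hi (u v : ℝ) : IntervalIntegrable g volume u v :=
    (hg.integrableOn_isCompact isCompact_uIcc).intervalIntegrable
  refine LipschitzWith.of_dist_le_mul fun s t => ?_
  rw [dist_eq_norm, intervalIntegral.integral_interval_sub_left (hi _ _) (hi _ _), Real.dist_eq]
  exact intervalIntegral.norm_integral_le_of_norm_le_const fun r _ => hC r

theorem LipschitzWith.norm_sub_le_integral_norm_deriv {C : ℝ≥0} {γ : ℝ → E}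
    (hγ : LipschitzWith C γ) {a b : ℝ} (hab : a ≤ b) :
    ‖γ b - γ a‖ ≤ ∫ t in a..b, ‖deriv γ t‖ := by
  have : CompleteSpace E := FiniteDimensional.complete ℝ E
  have hac : AbsolutelyContinuousOnInterval (fun t => γ t - ∫ s in a..t, deriv γ s) a b :=
    (hγ.lipschitzOnWith.absolutelyContinuousOnInterval).sub
      (lipschitzWith_intervalIntegral hγ.locallyIntegrable_deriv
        (fun t => norm_deriv_le_of_lipschitz hγ) a).lipschitzOnWith.absolutelyContinuousOnInterval
  obtain ⟨c, hc⟩ := hac.const_of_ae_hasDerivAt_zero (by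
    filter_upwards [hγ.ae_differentiableAt (μ := volume),
      LocallyIntegrable.ae_hasDerivAt_integral hγ.locallyIntegrable_deriv] with t h₁ h₂ _
    simpa using! h₁.hasDerivAt.sub (h₂ a))
  have ha := hc a left_mem_uIcc
  have hb := hc b right_mem_uIcc
  simp only [intervalIntegral.integral_same, sub_zero] at ha
  rw [ha, ← hb, sub_sub_cancel]
  exact intervalIntegral.norm_integral_le_integral_norm hab

/-- Change of variables along an arc length parameter `σ(t) = ∫₀ᵗ g`. -/
theorem integral_comp_primitive_mul {C : ℝ≥0} {g W : ℝ → ℝ} (hg : LocallyIntegrable g volume)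
    (hC : ∀ t, ‖g t‖ ≤ C) (hW : Continuous W) {a b : ℝ} :
    ∫ t in a..b, W (∫ s in a..t, g s) * g t = ∫ s in (0 : ℝ)..(∫ s in a..b, g s), W s := by
  set σ : ℝ → ℝ := fun t => ∫ s in a..t, g s with hσ
  set H : ℝ → ℝ := fun r => ∫ s in (0 : ℝ)..r, W s with hH
  have hσL : LipschitzWith C σ := lipschitzWith_intervalIntegral hg hC a
  have hHd (r : ℝ) : HasDerivAt H (W r) r := (hW.integral_hasStrictDerivAt 0 r).hasDerivAt
  obtain ⟨R, hR⟩ := (isCompact_uIcc.image hσL.continuous).isBounded.subset_closedBall (0 : ℝ)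
    (s := σ '' uIcc a b)
  obtain ⟨M, hM⟩ := (isCompact_closedBall (0 : ℝ) R).exists_bound_of_continuousOn hW.continuousOn
  have hHL : LipschitzOnWith M.toNNReal H (closedBall 0 R) :=
    (convex_closedBall 0 R).lipschitzOnWith_of_nnnorm_hasDerivWithin_le
      (fun r _ => (hHd r).hasDerivWithinAt) fun r hr => by
        rw [← NNReal.coe_le_coe, coe_nnnorm]
        exact (hM r hr).trans (Real.le_coe_toNNReal M)
  have hac : AbsolutelyContinuousOnInterval (H ∘ σ) a b :=
    (hHL.comp hσL.lipschitzOnWith fun t ht =>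
      hR (mem_image_of_mem σ ht)).absolutelyContinuousOnInterval
  have h := hac.integral_deriv_eq_sub
  have h0 : H (σ a) = 0 := by simp [hσ, hH]
  rw [Function.comp_apply, Function.comp_apply, h0, sub_zero] at h
  refine Eq.trans ?_ h
  refine intervalIntegral.integral_congr_ae ?_
  filter_upwards [LocallyIntegrable.ae_hasDerivAt_integral hg] with t ht _
  exact ((hHd (σ t)).comp t (ht a)).deriv.symm

/-- A weight that decreases at most linearly away from the endpoints of a path has integral along
the path bounded below in terms of its endpoint values. -/
theorem LipschitzWith.le_integral_mul_norm_deriv {C : ℝ≥0} {γ : ℝ → E} (hγ : LipschitzWith C γ)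
    {f : E → ℝ} (hf : Continuous f) (hf0 : ∀ z, 0 ≤ f z) {β : ℝ} (hβ : 0 ≤ β)
    (h₀ : ∀ z, f (γ 0) - β * ‖z - γ 0‖ ≤ f z) (h₁ : ∀ z, f (γ 1) - β * ‖z - γ 1‖ ≤ f z) :
    ‖γ 0 - γ 1‖ * ((f (γ 0) + f (γ 1)) / 2) - β / 4 * ‖γ 0 - γ 1‖ ^ 2 ≤
      ∫ t in Icc (0 : ℝ) 1, f (γ t) * ‖deriv γ t‖ := by
  rw [integral_Icc_eq_integral_Ioc, ← intervalIntegral.integral_of_le zero_le_one]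
  set A := f (γ 0)
  set B := f (γ 1)
  set L := ‖γ 0 - γ 1‖
  have hi (a b : ℝ) : IntervalIntegrable (fun t => ‖deriv γ t‖) volume a b :=
    (hγ.intervalIntegrable_deriv a b).norm
  have hli : LocallyIntegrable (fun t => ‖deriv γ t‖) volume :=
    fun t => (hγ.locallyIntegrable_deriv t).norm
  have hbd (t : ℝ) : ‖‖deriv γ t‖‖ ≤ C := by
    simpa using norm_deriv_le_of_lipschitz hγ
  set σ : ℝ → ℝ := fun t => ∫ s in (0 : ℝ)..t, ‖deriv γ s‖
  have hσc : Continuous σ := (lipschitzWith_intervalIntegral hli hbd 0).continuous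
  have hL0 : 0 ≤ L := norm_nonneg _
  have hLl : L ≤ σ 1 := by
    simpa only [L, norm_sub_rev] using hγ.norm_sub_le_integral_norm_deriv zero_le_one
  set l := σ 1
  set W : ℝ → ℝ := fun s => max 0 (max (A - β * s) (B - β * (l - s)))
  have hW : Continuous W := by fun_prop
  have hWf : ∀ t ∈ Icc (0 : ℝ) 1, W (σ t) ≤ f (γ t) := by
    intro t ht
    have e₀ : ‖γ t - γ 0‖ ≤ σ t := hγ.norm_sub_le_integral_norm_deriv ht.1
    have e₁ : ‖γ t - γ 1‖ ≤ l - σ t := by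
      have := hγ.norm_sub_le_integral_norm_deriv ht.2
      rw [← intervalIntegral.integral_interval_sub_left (hi 0 1) (hi 0 t), norm_sub_rev] at this
      exact this
    refine max_le (hf0 _) (max_le ?_ ?_)
    · exact le_trans (by gcongr) (h₀ (γ t))
    · exact le_trans (by gcongr) (h₁ (γ t))
  have key : ∫ s in (0 : ℝ)..l, W s ≤ ∫ t in (0 : ℝ)..1, f (γ t) * ‖deriv γ t‖ := by
    rw [← integral_comp_primitive_mul hli hbd hW]
    refine intervalIntegral.integral_mono_on zero_le_one
      ((hi 0 1).continuousOn_mul (hW.comp hσc).continuousOn)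
      ((hi 0 1).continuousOn_mul (hf.comp hγ.continuous).continuousOn) fun t ht => ?_
    exact mul_le_mul_of_nonneg_right (hWf t ht) (norm_nonneg _)
  refine le_trans ?_ key
  have hWi (a b : ℝ) : IntervalIntegrable W volume a b := hW.intervalIntegrable a b
  have i₁ : A * (L / 2) - β * (L / 2) ^ 2 / 2 ≤ ∫ s in (0 : ℝ)..(L / 2), W s := by
    have : ∫ s in (0 : ℝ)..(L / 2), (A - β * s) = A * (L / 2) - β * (L / 2) ^ 2 / 2 := by
      simp_rw [sub_eq_add_neg, ← neg_mul, integral_const_add_mul]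
      ring
    rw [← this]
    refine intervalIntegral.integral_mono_on (by positivity)
      (by apply Continuous.intervalIntegrable; fun_prop) (hWi _ _) fun s _ => ?_
    exact le_max_of_le_right (le_max_left _ _)
  have i₂ : 0 ≤ ∫ s in (L / 2)..(l - L / 2), W s :=
    intervalIntegral.integral_nonneg (by linarith) fun s _ => le_max_left _ _
  have i₃ : B * (L / 2) - β * (L / 2) ^ 2 / 2 ≤ ∫ s in (l - L / 2)..l, W s := by
    have : ∫ s in (l - L / 2)..l, (B - β * (l - s)) = B * (L / 2) - β * (L / 2) ^ 2 / 2 := by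
      rw [intervalIntegral.integral_comp_sub_left (fun s => B - β * s) l, sub_self, sub_sub_cancel]
      simp_rw [sub_eq_add_neg, ← neg_mul, integral_const_add_mul]
      ring
    rw [← this]
    refine intervalIntegral.integral_mono_on (by linarith)
      (by apply Continuous.intervalIntegrable; fun_prop) (hWi _ _) fun s _ => ?_
    exact le_max_of_le_right (le_max_right _ _)
  rw [← intervalIntegral.integral_add_adjacent_intervals (hWi 0 (l - L / 2)) (hWi _ l),
    ← intervalIntegral.integral_add_adjacent_intervals (hWi 0 (L / 2)) (hWi _ (l - L / 2))]
  linarith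

end Path

/-- Along a segment, a weight whose growth from the endpoints is at most linear has integral bounded
above in terms of its endpoint values. -/
theorem integral_segment_le {E : Type*} [NormedAddCommGroup E] [NormedSpace ℝ E]
    {f : E → ℝ} (hf : Continuous f) {β : ℝ} {x y : E}
    (hx : ∀ z ∈ segment ℝ x y, f z ≤ f x + β * ‖x - z‖)
    (hy : ∀ z ∈ segment ℝ x y, f z ≤ f y + β * ‖y - z‖) :
    ∫ t in Icc (0 : ℝ) 1, f ((1 - t) • x + t • y) ≤ (f x + f y) / 2 + β / 4 * ‖x - y‖ := by
  rw [integral_Icc_eq_integral_Ioc, ← intervalIntegral.integral_of_le zero_le_one]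
  have hc : Continuous fun t : ℝ => f ((1 - t) • x + t • y) := by fun_prop
  have hmem {t : ℝ} (h0 : 0 ≤ t) (h1 : t ≤ 1) : (1 - t) • x + t • y ∈ segment ℝ x y :=
    ⟨1 - t, t, by linarith, h0, by ring, rfl⟩
  have i₁ : ∫ t in (0 : ℝ)..(1 / 2), f ((1 - t) • x + t • y) ≤ f x / 2 + β / 8 * ‖x - y‖ := by
    have : ∫ t in (0 : ℝ)..(1 / 2), (f x + β * ‖x - y‖ * t) = f x / 2 + β / 8 * ‖x - y‖ := by
      rw [integral_const_add_mul]
      ring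
    rw [← this]
    refine intervalIntegral.integral_mono_on (by norm_num) (hc.intervalIntegrable _ _)
      (by apply Continuous.intervalIntegrable; fun_prop) fun t ht => ?_
    refine (hx _ (hmem ht.1 (by linarith [ht.2]))).trans_eq ?_
    rw [show x - ((1 - t) • x + t • y) = t • (x - y) by module, norm_smul,
      Real.norm_of_nonneg ht.1]
    ring
  have i₂ : ∫ t in (1 / 2 : ℝ)..1, f ((1 - t) • x + t • y) ≤ f y / 2 + β / 8 * ‖x - y‖ := by
    have : ∫ t in (1 / 2 : ℝ)..1, (f y + β * ‖x - y‖ * (1 - t)) =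
        f y / 2 + β / 8 * ‖x - y‖ := by
      rw [intervalIntegral.integral_comp_sub_left (fun t => f y + β * ‖x - y‖ * t) 1, sub_self,
        integral_const_add_mul]
      ring
    rw [← this]
    refine intervalIntegral.integral_mono_on (by norm_num) (hc.intervalIntegrable _ _)
      (by apply Continuous.intervalIntegrable; fun_prop) fun t ht => ?_
    refine (hy _ (hmem (by linarith [ht.1]) ht.2)).trans_eq ?_
    rw [show y - ((1 - t) • x + t • y) = (1 - t) • (y - x) by module, norm_smul,
      Real.norm_of_nonneg (by linarith [ht.2]), norm_sub_rev y x]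
    ring
  rw [← intervalIntegral.integral_add_adjacent_intervals (hc.intervalIntegrable 0 (1 / 2))
    (hc.intervalIntegrable _ 1)]
  linarith

section DTM

variable {d : ℕ}

theorem exists_lt_measure_ball (μ : Measure (Euc d)) [IsProbabilityMeasure μ] {u : ℝ} (hu : u < 1)
    (x : Euc d) : ∃ r, 0 < r ∧ u < (μ (ball x r)).toReal := by
  have h : Filter.Tendsto (fun r : ℝ => (μ (ball x r)).toReal) Filter.atTop (nhds 1) := by
    have h := tendsto_measure_iUnion_atTop (μ := μ) (s := fun r : ℝ => ball x r)
      fun _ _ hrs => ball_subset_ball hrs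
    rw [iUnion_eq_univ_iff.2 fun z => ⟨dist z x + 1, by simp⟩, measure_univ] at h
    simpa using! (ENNReal.tendsto_toReal ENNReal.one_ne_top).comp h
  exact ((Filter.eventually_gt_atTop 0).and (h.eventually_const_lt hu)).exists

theorem pseudoDTM_nonneg (μ : Measure (Euc d)) (u : ℝ) (x : Euc d) : 0 ≤ pseudoDTM μ u x :=
  Real.sInf_nonneg fun _ hr => hr.1.le

theorem pseudoDTM_le {μ : Measure (Euc d)} {u r : ℝ} {x : Euc d} (hr : 0 < r)
    (h : u < (μ (ball x r)).toReal) : pseudoDTM μ u x ≤ r :=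
  csInf_le ⟨0, fun _ hs => hs.1.le⟩ ⟨hr, h⟩

theorem pseudoDTM_le_add_dist (μ : Measure (Euc d)) [IsProbabilityMeasure μ] {u : ℝ} (hu : u < 1)
    (x y : Euc d) : pseudoDTM μ u x ≤ pseudoDTM μ u y + dist x y := by
  rw [← sub_le_iff_le_add]
  refine le_csInf (exists_lt_measure_ball μ hu y) fun r hr => ?_
  rw [sub_le_iff_le_add]
  refine pseudoDTM_le (add_pos_of_pos_of_nonneg hr.1 dist_nonneg) (hr.2.trans_le ?_)
  refine ENNReal.toReal_mono (measure_ne_top _ _) (measure_mono (ball_subset_ball' ?_))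
  rw [dist_comm]

theorem monotoneOn_pseudoDTM (μ : Measure (Euc d)) [IsProbabilityMeasure μ] (x : Euc d) :
    MonotoneOn (fun u => pseudoDTM μ u x) (Iio 1) := fun _ _ _ hv huv =>
  le_csInf (exists_lt_measure_ball μ hv x) fun _ hr => pseudoDTM_le hr.1 (huv.trans_lt hr.2)

theorem pseudoDTM_le_diam {μ : Measure (Euc d)} [IsProbabilityMeasure μ] {K : Set (Euc d)}
    (hK : Bornology.IsBounded K) (hsupp : measSupport μ ⊆ K) {u : ℝ} (hu : u < 1)
    {x : Euc d} (hx : x ∈ K) : pseudoDTM μ u x ≤ diam K := by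
  have hs : μ.support ⊆ K := fun z hz => hsupp fun r hr =>
    (Measure.mem_support_iff_forall z).1 hz _ (ball_mem_nhds z hr)
  refine le_of_forall_gt_imp_ge_of_dense fun r hr => pseudoDTM_le (diam_nonneg.trans_lt hr) ?_
  have hsub : μ.support ⊆ ball x r := fun z hz =>
    (dist_le_diam_of_mem hK (hs hz) hx).trans_lt hr
  have h1 : μ (ball x r) = 1 := by
    rw [prob_compl_eq_zero_iff measurableSet_ball |>.symm]
    exact measure_mono_null (compl_subset_compl.2 hsub) Measure.measure_compl_support
  simpa [h1] using hu

/-- The uniform probability measure on `(0, m]`. -/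
def unifIoc (m : ℝ) : Measure ℝ := ENNReal.ofReal (1 / m) • volume.restrict (Ioc 0 m)

theorem isProbabilityMeasure_unifIoc {m : ℝ} (hm : 0 < m) : IsProbabilityMeasure (unifIoc m) :=
  ⟨by simp [unifIoc, ← ENNReal.ofReal_mul, hm.le, hm.ne']⟩

theorem ae_mem_Ioc_unifIoc (m : ℝ) : ∀ᵐ u ∂unifIoc m, u ∈ Ioc 0 m :=
  Measure.ae_smul_measure (ae_restrict_mem measurableSet_Ioc) _

theorem memLp_pseudoDTM {m : ℝ} (hm : m ∈ Ioo (0 : ℝ) 1) (p : ℝ≥0∞) (μ : Measure (Euc d))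
    [IsProbabilityMeasure μ] (x : Euc d) :
    MemLp (fun u => pseudoDTM μ u x) p (unifIoc m) := by
  have := isProbabilityMeasure_unifIoc hm.1
  refine MemLp.of_bound ?_ (pseudoDTM μ m x) ?_
  · exact ((aemeasurable_restrict_of_monotoneOn measurableSet_Ioc
      ((monotoneOn_pseudoDTM μ x).mono fun u hu => hu.2.trans_lt hm.2)).smul_measure
      _).aestronglyMeasurable
  · filter_upwards [ae_mem_Ioc_unifIoc m] with u hu
    rw [Real.norm_of_nonneg (pseudoDTM_nonneg _ _ _)]
    exact monotoneOn_pseudoDTM μ x (hu.2.trans_lt hm.2) hm.2 hu.2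

theorem dtm_eq_toReal_eLpNorm {m p : ℝ} (hm : m ∈ Ioo (0 : ℝ) 1) (hp : 1 ≤ p) (μ : Measure (Euc d))
    [IsProbabilityMeasure μ] (x : Euc d) :
    dtm m p μ x =
      (eLpNorm (fun u => pseudoDTM μ u x) (ENNReal.ofReal p) (unifIoc m)).toReal := by
  have hp0 : 0 < p := by linarith
  rw [toReal_eLpNorm (memLp_pseudoDTM hm (ENNReal.ofReal p) μ x).1,
    lpNorm_eq_integral_norm_rpow_toReal (by simpa using hp0) (by simp)
      (memLp_pseudoDTM hm (ENNReal.ofReal p) μ x).1, ENNReal.toReal_ofReal hp0.le, dtm, unifIoc,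
    integral_smul_measure, ENNReal.toReal_ofReal (one_div_nonneg.2 hm.1.le)]
  simp [abs_of_nonneg (pseudoDTM_nonneg _ _ _)]

theorem dtm_nonneg {m p : ℝ} (hm : 0 ≤ m) (μ : Measure (Euc d)) (x : Euc d) :
    0 ≤ dtm m p μ x :=
  Real.rpow_nonneg (mul_nonneg (one_div_nonneg.2 hm)
    (integral_nonneg fun _ => Real.rpow_nonneg (pseudoDTM_nonneg _ _ _) _)) _

theorem dtm_le_add_dist {m p : ℝ} (hm : m ∈ Ioo (0 : ℝ) 1) (hp : 1 ≤ p) (μ : Measure (Euc d))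
    [IsProbabilityMeasure μ] (x y : Euc d) : dtm m p μ x ≤ dtm m p μ y + dist x y := by
  have := isProbabilityMeasure_unifIoc hm.1
  have hp' : 1 ≤ ENNReal.ofReal p := by simpa using hp
  have hc : eLpNorm (fun _ : ℝ => dist x y) (ENNReal.ofReal p) (unifIoc m) =
      ENNReal.ofReal (dist x y) := by
    rw [eLpNorm_const _ (zero_lt_one.trans_le hp').ne' (NeZero.ne _)]
    simp [Real.enorm_of_nonneg]
  have hy := memLp_pseudoDTM hm (ENNReal.ofReal p) μ y
  have h : eLpNorm (fun u => pseudoDTM μ u x) (ENNReal.ofReal p) (unifIoc m) ≤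
      eLpNorm (fun u => pseudoDTM μ u y) (ENNReal.ofReal p) (unifIoc m) +
        ENNReal.ofReal (dist x y) := by
    rw [← hc]
    refine le_trans ?_ (eLpNorm_add_le hy.1 aestronglyMeasurable_const hp')
    refine eLpNorm_mono_ae_real ?_
    filter_upwards [ae_mem_Ioc_unifIoc m] with u hu
    rw [Real.norm_of_nonneg (pseudoDTM_nonneg _ _ _)]
    exact pseudoDTM_le_add_dist μ (hu.2.trans_lt hm.2) x y
  rw [dtm_eq_toReal_eLpNorm hm hp, dtm_eq_toReal_eLpNorm hm hp]
  refine (ENNReal.toReal_mono (ENNReal.add_ne_top.2 ⟨hy.2.ne, ENNReal.ofReal_ne_top⟩) h).trans_eq ?_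
  rw [ENNReal.toReal_add hy.2.ne ENNReal.ofReal_ne_top, ENNReal.toReal_ofReal dist_nonneg]

theorem continuous_dtm {m p : ℝ} (hm : m ∈ Ioo (0 : ℝ) 1) (hp : 1 ≤ p) (μ : Measure (Euc d))
    [IsProbabilityMeasure μ] : Continuous (dtm m p μ) :=
  (LipschitzWith.of_le_add (dtm_le_add_dist hm hp μ)).continuous

theorem dtm_le_diam {m p : ℝ} (hm : m ∈ Ioo (0 : ℝ) 1) (hp : 1 ≤ p) {μ : Measure (Euc d)}
    [IsProbabilityMeasure μ] {K : Set (Euc d)} (hK : Bornology.IsBounded K)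
    (hsupp : measSupport μ ⊆ K) {x : Euc d} (hx : x ∈ K) : dtm m p μ x ≤ diam K := by
  have := isProbabilityMeasure_unifIoc hm.1
  rw [dtm_eq_toReal_eLpNorm hm hp]
  refine ENNReal.toReal_le_of_le_ofReal diam_nonneg ?_
  refine (eLpNorm_le_of_ae_bound (C := diam K) ?_).trans_eq (by simp)
  filter_upwards [ae_mem_Ioc_unifIoc m] with u hu
  rw [Real.norm_of_nonneg (pseudoDTM_nonneg _ _ _)]
  exact pseudoDTM_le_diam hK hsupp (hu.2.trans_lt hm.2) hx

/-- On `[0, 1]` the map `a ↦ a ^ β` decreases at rate at most `β`. -/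
theorem rpow_sub_mul_le_rpow {a b r β : ℝ} (ha0 : 0 ≤ a) (ha1 : a ≤ 1) (hb : 0 ≤ b)
    (hβ : 1 ≤ β) (hr : 0 ≤ r) (h : a ≤ b + r) : a ^ β - β * r ≤ b ^ β := by
  rcases ha0.eq_or_lt with rfl | ha
  · rw [Real.zero_rpow (by linarith)]
    have := Real.rpow_nonneg hb β
    nlinarith [mul_nonneg (zero_le_one.trans hβ) hr]
  rcases le_total a b with hab | hab
  · have := Real.rpow_le_rpow ha0 hab (zero_le_one.trans hβ)
    nlinarith [mul_nonneg (zero_le_one.trans hβ) hr]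
  have hs : -1 ≤ b / a - 1 := by linarith [div_nonneg hb ha0]
  have hB := one_add_mul_self_le_rpow_one_add hs hβ
  rw [add_sub_cancel, Real.div_rpow hb ha0, le_div_iff₀ (Real.rpow_pos_of_pos ha β)] at hB
  have haβ : a ^ β ≤ a := by
    simpa using Real.rpow_le_rpow_of_exponent_ge ha ha1 hβ
  have e : (1 + β * (b / a - 1)) * a ^ β = a ^ β - β * (a - b) * (a ^ β / a) := by
    field_simp
    ring
  have h1 : a ^ β / a ≤ 1 := (div_le_one ha).2 haβ
  have h2 : β * (a - b) * (a ^ β / a) ≤ β * (a - b) * 1 :=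
    mul_le_mul_of_nonneg_left h1 (mul_nonneg (zero_le_one.trans hβ) (by linarith))
  have h3 : β * (a - b) ≤ β * r := by gcongr; linarith
  linarith

theorem dtm_rpow_sub_le {m p β : ℝ} (hm : m ∈ Ioo (0 : ℝ) 1) (hp : 1 ≤ p) (hβ : 1 ≤ β)
    {μ : Measure (Euc d)} [IsProbabilityMeasure μ] {K : Set (Euc d)} (hK : Bornology.IsBounded K)
    (hKdiam : diam K ≤ 1) (hsupp : measSupport μ ⊆ K) {x : Euc d} (hx : x ∈ K) (z : Euc d) :
    dtm m p μ x ^ β - β * ‖z - x‖ ≤ dtm m p μ z ^ β :=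
  rpow_sub_mul_le_rpow (dtm_nonneg hm.1.le μ x) ((dtm_le_diam hm hp hK hsupp hx).trans hKdiam)
    (dtm_nonneg hm.1.le μ z) hβ (norm_nonneg _)
    (by rw [norm_sub_rev, ← dist_eq_norm]; exact dtm_le_add_dist hm hp μ x z)

theorem admissiblePath_segment (F : Set (Euc d)) {x y : Euc d} (hxy : x ≠ y) :
    AdmissiblePath F x y (fun t => (1 - t) • x + t • y) := by
  have hd (t : ℝ) : HasDerivAt (fun t : ℝ => (1 - t) • x + t • y) (y - x) t := by
    simpa [sub_eq_neg_add] using! (((hasDerivAt_id t).const_sub 1).smul_const x).add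
      ((hasDerivAt_id t).smul_const y)
  refine ⟨⟨‖y - x‖₊, ?_⟩, by simp, by simp, fun a b _ _ _ => ?_⟩
  · exact lipschitzWith_of_nnnorm_deriv_le (fun t => (hd t).differentiableAt) fun t => by
      rw [(hd t).deriv]
  · have hne : ‖y - x‖ ≠ 0 := norm_ne_zero_iff.2 (sub_ne_zero.2 hxy.symm)
    refine ⟨‖y - x‖⁻¹ • (y - x), by simp [norm_smul, hne], .of_forall fun t => ?_⟩
    rw [(hd t).deriv, smul_inv_smul₀ hne]

end DTM

theorem segFDTM_le_fdtm_add {d : ℕ} (m p β : ℝ) (hm : m ∈ Set.Ioo (0 : ℝ) 1) (hp : 1 ≤ p)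
    (hβ : 1 ≤ β) (K : Set (Euc d)) (hKc : IsCompact K) (hKconv : Convex ℝ K)
    (hKdiam : diam K ≤ 1)
    (μ : Measure (Euc d)) [IsProbabilityMeasure μ] (hsupp : measSupport μ ⊆ K)
    (F : Set (Euc d)) (hFK : F ⊆ K) (hF : IsClosed F) (hFne : F.Nonempty)
    (x y : Euc d) (hx : x ∈ K) (hy : y ∈ K) :
    segFDTM m p β μ x y ≤ fdtm m p β μ F x y + (β / 2) * ‖x - y‖ ^ 2 := by
  have hK := hKc.isBounded
  have hβ0 : 0 ≤ β := by linarith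
  have hcont : Continuous fun z => dtm m p μ z ^ β :=
    (continuous_dtm hm hp μ).rpow_const fun _ => Or.inr hβ0
  have hnn (z : Euc d) : 0 ≤ dtm m p μ z ^ β := Real.rpow_nonneg (dtm_nonneg hm.1.le μ z) β
  have hlow {z : Euc d} (hz : z ∈ K) (w : Euc d) :
      dtm m p μ z ^ β - β * ‖w - z‖ ≤ dtm m p μ w ^ β :=
    dtm_rpow_sub_le hm hp hβ hK hKdiam hsupp hz w
  rcases eq_or_ne x y with rfl | hxy
  · have h : 0 ≤ fdtm m p β μ F x x := by
      refine Real.sInf_nonneg ?_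
      rintro _ ⟨γ, _, rfl⟩
      exact integral_nonneg fun t => mul_nonneg (hnn _) (norm_nonneg _)
    simpa [segFDTM] using h
  rw [← sub_le_iff_le_add]
  refine le_csInf ⟨_, _, admissiblePath_segment F hxy, rfl⟩ ?_
  rintro _ ⟨γ, ⟨⟨C, hγ⟩, rfl, rfl, _⟩, rfl⟩
  have hpath := hγ.le_integral_mul_norm_deriv hcont hnn hβ0 (hlow hx) (hlow hy)
  have hseg := integral_segment_le (x := γ 0) (y := γ 1) (β := β) hcont
    (fun z hz => by linarith [hlow (hKconv.segment_subset hx hy hz) (γ 0)])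
    (fun z hz => by linarith [hlow (hKconv.segment_subset hx hy hz) (γ 1)])
  have hmul := mul_le_mul_of_nonneg_left hseg (norm_nonneg (γ 0 - γ 1))
  unfold segFDTM fdtmLength
  nlinarith [hpath, hmul]

end
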